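/- arXiv:1702.01969 — 2 statements merged into one kernel-verified Lean document; each statement's English description precedes it below -/
import Mathlib

section
/- Let K be a subfield of U with σ(K) = K, and let b ∈ U be algebraic over K. For n ≥ 0 write K_n := K(b, σ(b), …, σⁿ(b)). Then for every n ≥ 0 the forward and backward relative degrees agree: [K_{n+1} : K_n] = [K_{n+1} : K(σ(b), σ²(b), …, σ^{n+1}(b))]. In particular the limit degree ld(b/K) and the inverse limit degree ild(b/K) of an element algebraic over K are equal. -/
set_option synthInstance.maxHeartbeats 800000
set_option maxHeartbeats 1600000

theorem aux_integral {U : Type*} [Field U] (σ : U ≃+* U) (K : Subfield U)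
    (hK : K.map (σ : U →+* U) = K) (b : U) (hb : IsIntegral K b) (i : ℕ) :
    IsIntegral K ((σ ^ i) b) := by
  induction i with
  | zero => simpa using hb
  | succ i ih =>
    have hm : ∀ x : K, (σ : U →+* U) x ∈ K := fun x => by
      have h : (σ : U →+* U) x ∈ K.map (σ : U →+* U) := ⟨x, x.2, rfl⟩
      rwa [hK] at h
    have h := ih.map_of_comp_eq
      (((σ : U →+* U).comp K.subtype).codRestrict K hm) (σ : U →+* U) (by ext x; rfl)
    rw [pow_succ']
    exact h

theorem aux_finrank {U : Type*} [Field U] (A B : Subfield U) (h : A ≤ B) :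
    letI : Algebra A B := (Subfield.inclusion h).toAlgebra
    Module.finrank A B = A.relfinrank B := by
  rw [Subfield.relfinrank_eq_finrank_of_le h]
  rfl

theorem aux_ne_zero {U : Type*} [Field U] (K : Subfield U) (S : Set U) [Finite S]
    (hS : ∀ x ∈ S, IsIntegral K x) :
    K.relfinrank (Subfield.closure ((K : Set U) ∪ S)) ≠ 0 := by
  have hle : K ≤ Subfield.closure ((K : Set U) ∪ S) :=
    fun x hx => Subfield.subset_closure (Or.inl hx)
  have he : Subfield.extendScalars hle = IntermediateField.adjoin K S := by
    apply IntermediateField.toSubfield_injective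
    rw [Subfield.extendScalars_toSubfield, IntermediateField.adjoin_toSubfield]
    congr 2
    ext x
    simp [Subfield.algebraMap_ofSubfield]
  rw [Subfield.relfinrank_eq_finrank_of_le hle, he]
  have := IntermediateField.finiteDimensional_adjoin hS
  exact Module.finrank_pos.ne'

/-- Let `U` be a field with automorphism `σ`, `K` a subfield
with `σ(K) = K`, and `b ∈ U` algebraic over `K`.  With
`K_n = K(b, σ b, …, σⁿ b)` and `K'_n = K(σ b, σ² b, …, σ^{n+1} b)`, one has
`[K_{n+1} : K_n] = [K_{n+1} : K'_n]` for every `n ≥ 0`.  In particular the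
limit degree and the inverse limit degree of an element algebraic over `K`
are equal. -/
theorem statement5 (U : Type*) [Field U] (σ : U ≃+* U) (K : Subfield U)
    (hK : K.map (σ : U →+* U) = K)
    (b : U) (hb : IsAlgebraic K b)
    (Kn : ℕ → Subfield U)
    (hKn : ∀ n, Kn n =
      Subfield.closure ((K : Set U) ∪ {x | ∃ i ≤ n, x = (σ ^ i) b}))
    (K'n : ℕ → Subfield U)
    (hK'n : ∀ n, K'n n =
      Subfield.closure ((K : Set U) ∪ {x | ∃ i, 1 ≤ i ∧ i ≤ n + 1 ∧ x = (σ ^ i) b}))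
    (hle : ∀ n, Kn n ≤ Kn (n + 1))
    (hle' : ∀ n, K'n n ≤ Kn (n + 1)) :
    ∀ n : ℕ,
      letI : Algebra (Kn n) (Kn (n + 1)) := (Subfield.inclusion (hle n)).toAlgebra
      letI : Algebra (K'n n) (Kn (n + 1)) := (Subfield.inclusion (hle' n)).toAlgebra
      Module.finrank (Kn n) (Kn (n + 1)) = Module.finrank (K'n n) (Kn (n + 1)) := by
  intro n
  rw [aux_finrank, aux_finrank]
  have hKl : K ≤ Kn n := by
    rw [hKn]; exact fun x hx => Subfield.subset_closure (Or.inl hx)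
  have hKl' : K ≤ K'n n := by
    rw [hK'n]; exact fun x hx => Subfield.subset_closure (Or.inl hx)
  have hmap : (Kn n).map (σ : U →+* U) = K'n n := by
    rw [hKn, hK'n, RingHom.map_field_closure, Set.image_union]
    congr 2
    · exact congrArg (fun L : Subfield U => (L : Set U)) hK
    · ext x
      constructor
      · rintro ⟨_, ⟨i, hi, rfl⟩, rfl⟩
        exact ⟨i + 1, by omega, by omega, by rw [pow_succ']; rfl⟩
      · rintro ⟨i, h1, hi, rfl⟩
        obtain ⟨j, rfl⟩ := Nat.exists_eq_add_of_le' h1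
        exact ⟨(σ ^ j) b, ⟨j, by omega, rfl⟩, by rw [pow_succ']; rfl⟩
  have heq : K.relfinrank (K'n n) = K.relfinrank (Kn n) := by
    rw [← hmap]
    conv_lhs => rw [← hK]
    exact Subfield.relfinrank_map_map _ _ _
  have hne : K.relfinrank (Kn n) ≠ 0 := by
    rw [hKn]
    have : Finite {x | ∃ i ≤ n, x = (σ ^ i) b} := by
      refine Set.Finite.subset ((Set.finite_Iic n).image fun i => (σ ^ i) b) ?_
      rintro _ ⟨i, hi, rfl⟩
      exact ⟨i, hi, rfl⟩
    apply aux_ne_zero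
    rintro _ ⟨i, _, rfl⟩
    exact aux_integral σ K hK b hb.isIntegral i
  have e1 := Subfield.relfinrank_mul_relfinrank hKl (hle n)
  have e2 := Subfield.relfinrank_mul_relfinrank hKl' (hle' n)
  rw [heq] at e2
  exact Nat.eq_of_mul_eq_mul_left (Nat.pos_of_ne_zero hne) (e1.trans e2.symm)
end

section
/- Let K be a subfield of U with σ(K) = K, let a ∈ K be nonzero, and let b ∈ U be transcendental over K with σ(b) = a·b². Then (i) σⁿ(b) ∈ K(b) for every n ≥ 0, so that K(b, σ(b), …, σⁿ(b)) = K(b) for all n and hence the limit degree ld(b/K) equals 1; and (ii) [K(b) : K(σ(b))] = 2, so that the inverse limit degree ild(b/K) equals 2. Consequently Δ(b/K) := ld(b/K)/ild(b/K) = 1/2. -/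
set_option synthInstance.maxHeartbeats 800000
set_option maxHeartbeats 1600000

open Polynomial in
theorem aux_notMem {U : Type*} [Field U] (K : Subfield U) (a b : U) (haK : a ∈ K) (ha : a ≠ 0)
    (hb : Transcendental K b) :
    b ∉ Subfield.closure ((K : Set U) ∪ {a * b ^ 2}) := by
  intro h
  have hle : Subfield.closure ((K : Set U) ∪ {a * b ^ 2}) ≤
      (IntermediateField.adjoin K {b ^ 2}).toSubfield := by
    rw [Subfield.closure_le]
    rintro x (hx | hx)
    · exact (IntermediateField.adjoin K {b ^ 2}).algebraMap_mem ⟨x, hx⟩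
    · rw [Set.mem_singleton_iff] at hx
      subst hx
      exact (IntermediateField.adjoin K {b ^ 2}).mul_mem
        ((IntermediateField.adjoin K {b ^ 2}).algebraMap_mem ⟨a, haK⟩)
        (IntermediateField.mem_adjoin_simple_self K _)
  have h2 : b ∈ IntermediateField.adjoin K {b ^ 2} := hle h
  rw [IntermediateField.mem_adjoin_simple_iff] at h2
  obtain ⟨r, s, hrs⟩ := h2
  have hb0 : b ≠ 0 := by
    rintro rfl
    exact hb isAlgebraic_zero
  have hs0 : aeval (b ^ 2) s ≠ 0 := by
    intro h0
    rw [h0, div_zero] at hrs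
    exact hb0 hrs
  rw [eq_div_iff hs0, ← expand_aeval, ← expand_aeval] at hrs
  have hz : X * expand K 2 s - expand K 2 r = 0 := by
    by_contra hne
    refine hb ⟨_, hne, ?_⟩
    rw [map_sub, map_mul, aeval_X, hrs, sub_self]
  have hs : s ≠ 0 := by
    rintro rfl
    simp at hs0
  have hd := congrArg natDegree (sub_eq_zero.mp hz)
  rw [natDegree_X_mul (by rwa [Ne, expand_eq_zero (by norm_num)]), natDegree_expand,
    natDegree_expand] at hd
  omega

open Polynomial in
theorem aux_finrank_s7 {U : Type*} [Field U] (F : Subfield U) (a b : U) (haF : a ∈ F) (ha : a ≠ 0)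
    (hF : a * b ^ 2 ∈ F) (hb : b ∉ F) :
    Module.finrank F (IntermediateField.adjoin F {b}) = 2 := by
  have hc : b ^ 2 ∈ F := by
    have := F.mul_mem (F.inv_mem haF) hF
    rwa [inv_mul_cancel_left₀ ha] at this
  have hm : (X ^ 2 - C (⟨b ^ 2, hc⟩ : F)).Monic := monic_X_pow_sub_C _ (by norm_num)
  have he : aeval b (X ^ 2 - C (⟨b ^ 2, hc⟩ : F)) = 0 := by
    rw [map_sub, map_pow, aeval_X, aeval_C]
    exact sub_self _
  have hi : IsIntegral F b := ⟨_, hm, he⟩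
  rw [IntermediateField.adjoin.finrank hi]
  apply le_antisymm
  · have := natDegree_le_of_dvd (minpoly.dvd F b he) hm.ne_zero
    rwa [natDegree_X_pow_sub_C] at this
  · rw [minpoly.two_le_natDegree_iff hi]
    rintro ⟨x, rfl⟩
    exact hb x.2

/-- Let `U` be a field with automorphism `σ`, `K` a subfield
with `σ(K) = K`, `a ∈ K` nonzero, and `b ∈ U` transcendental over `K` with
`σ b = a·b²`.  Then:
(i) `σⁿ b ∈ K(b)` for every `n`, so `K_n := K(b, σ b, …, σⁿ b) = K(b)` for all
`n`, hence `[K_{n+1} : K_n] = [K_n(σ^{n+1} b) : K_n] = 1` and the limit degree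
`ld(b/K) = 1`;
(ii) `[K(b) : K(σ b)] = [K(σ b)(b) : K(σ b)] = 2`, and moreover
`[K_{n+1} : K'_n] = [K'_n(b) : K'_n] = 2` for every `n`, where
`K'_n := K(σ b, …, σ^{n+1} b)`, so the inverse limit degree `ild(b/K) = 2`.
Consequently `Δ(b/K) = ld(b/K)/ild(b/K) = 1/2`. -/
theorem statement7 (U : Type*) [Field U] (σ : U ≃+* U) (K : Subfield U)
    (hK : K.map (σ : U →+* U) = K)
    (a : U) (haK : a ∈ K) (ha : a ≠ 0)
    (b : U) (hb : Transcendental K b)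
    (hσb : σ b = a * b ^ 2)
    -- `Kb = K(b)`, `Kσb = K(σ b)`, `Kn n = K(b, σ b, …, σⁿ b)`,
    -- `K'n n = K(σ b, …, σ^{n+1} b)` :
    (Kb Kσb : Subfield U) (Kn K'n : ℕ → Subfield U)
    (hKb : Kb = Subfield.closure ((K : Set U) ∪ {b}))
    (hKσb : Kσb = Subfield.closure ((K : Set U) ∪ {σ b}))
    (hKn : ∀ n, Kn n = Subfield.closure ((K : Set U) ∪ {x | ∃ i ≤ n, x = (σ ^ i) b}))
    (hK'n : ∀ n, K'n n =
      Subfield.closure ((K : Set U) ∪ {x | ∃ i, 1 ≤ i ∧ i ≤ n + 1 ∧ x = (σ ^ i) b})) :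
    -- (i) every `σⁿ b` lies in `K(b)`, and `K_n = K(b)` for all `n`
    (∀ n : ℕ, (σ ^ n) b ∈ Kb) ∧ (∀ n : ℕ, Kn n = Kb) ∧
    -- hence `[K_{n+1} : K_n] = [K_n(σ^{n+1} b) : K_n] = 1`, i.e. `ld(b/K) = 1`
    (∀ n : ℕ,
      Module.finrank (Kn n) (IntermediateField.adjoin (Kn n) {(σ ^ (n + 1)) b}) = 1) ∧
    -- (ii) `[K(b) : K(σ b)] = [K(σ b)(b) : K(σ b)] = 2`
    (Module.finrank Kσb (IntermediateField.adjoin Kσb {b}) = 2) ∧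
    -- and `[K_{n+1} : K'_n] = [K'_n(b) : K'_n] = 2` for every `n`,
    -- i.e. `ild(b/K) = 2` and `Δ(b/K) = 1/2`
    (∀ n : ℕ, Module.finrank (K'n n) (IntermediateField.adjoin (K'n n) {b}) = 2) := by
  have hKm : ∀ n : ℕ, ∀ x ∈ K, (σ ^ n) x ∈ K := by
    intro n
    induction n with
    | zero => intro x hx; simpa using hx
    | succ n ih =>
      intro x hx
      rw [pow_succ, RingAut.mul_apply]
      apply ih
      rw [← hK]
      exact ⟨x, hx, rfl⟩
  have hstep : ∀ n : ℕ, (σ ^ (n + 1)) b = (σ ^ n) a * ((σ ^ n) b) ^ 2 := by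
    intro n
    rw [pow_succ, RingAut.mul_apply, hσb, map_mul, map_pow]
  have hK1 : (K : Set U) ⊆ Kb := by
    rw [hKb]; exact Set.subset_union_left.trans Subfield.subset_closure
  have hK2 : (K : Set U) ⊆ Kσb := by
    rw [hKσb]; exact Set.subset_union_left.trans Subfield.subset_closure
  have hb1 : b ∈ Kb := by
    rw [hKb]; exact Subfield.subset_closure (Or.inr rfl)
  have hb2 : σ b ∈ Kσb := by
    rw [hKσb]; exact Subfield.subset_closure (Or.inr rfl)
  have h1 : ∀ n : ℕ, (σ ^ n) b ∈ Kb := by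
    intro n
    induction n with
    | zero => simpa using hb1
    | succ n ih =>
      rw [hstep]
      exact Kb.mul_mem (hK1 (hKm n a haK)) (Kb.pow_mem ih 2)
  have h2 : ∀ n : ℕ, (σ ^ (n + 1)) b ∈ Kσb := by
    intro n
    induction n with
    | zero => simpa using hb2
    | succ n ih =>
      rw [hstep]
      exact Kσb.mul_mem (hK2 (hKm _ a haK)) (Kσb.pow_mem ih 2)
  have h3 : ∀ n, Kn n = Kb := by
    intro n
    apply le_antisymm
    · rw [hKn, Subfield.closure_le]
      rintro x (hx | ⟨i, -, rfl⟩)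
      · exact hK1 hx
      · exact h1 i
    · rw [hKn, hKb]
      apply Subfield.closure_mono
      apply Set.union_subset_union_right
      rintro x rfl
      exact ⟨0, Nat.zero_le _, by simp⟩
  have h4 : ∀ n, K'n n = Kσb := by
    intro n
    apply le_antisymm
    · rw [hK'n, Subfield.closure_le]
      rintro x (hx | ⟨i, hi, -, rfl⟩)
      · exact hK2 hx
      · obtain ⟨j, rfl⟩ := Nat.exists_eq_add_of_le' hi
        exact h2 j
    · rw [hK'n, hKσb]
      apply Subfield.closure_mono
      apply Set.union_subset_union_right
      rintro x rfl
      exact ⟨1, le_rfl, by omega, by simp⟩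
  have h5 : Module.finrank Kσb (IntermediateField.adjoin Kσb {b}) = 2 := by
    apply aux_finrank_s7 Kσb a b (hK2 haK) ha (hσb ▸ hb2)
    rw [hKσb, hσb]
    exact aux_notMem K a b haK ha hb
  refine ⟨h1, h3, ?_, h5, ?_⟩
  · intro n
    rw [h3 n, IntermediateField.finrank_adjoin_simple_eq_one_iff]
    exact (IntermediateField.mem_bot).2 ⟨⟨_, h1 (n + 1)⟩, rfl⟩
  · intro n
    rw [h4 n]
    exact h5
end
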